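/- Let φ : R_A → R_B be a graded ring isomorphism that is k-stable, let ℓ := ht(φ(x_{k+1})), assume ℓ > k+1, and assume p := b_{ℓ,ℓ−1} is odd. Write φ(x_{k+1}) = ε(2y_ℓ − β̄_ℓ) + w with ε ∈ ℚ nonzero and w ∈ F_k(B) ⊗ ℚ, where β̄_m := Σ_{j=k+1}^{m−1} b_{m j} y_j, and set u := (φ(α_{k+1}) − 2w)/ε. Then: (i) β_{ℓ−1} = β̄_{ℓ−1} − u/p in H²(B) ⊗ ℚ; (ii) every coefficient b_{ℓ−1, j} for k+1 ≤ j ≤ ℓ−2 is even, so v := β̄_{ℓ−1}/2 lies in F_{ℓ−2}(B); and (iii) v(β_{ℓ−1} − v) = 0 in R_B. -/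

import Mathlib

open MvPolynomial

namespace Bott

/-- A square integer matrix indexed by `Fin n` (rows, columns).  We think of it as the
matrix `A = (a_{ij})` defining a Bott tower; strict lower triangularity is the
predicate `SLT` below. -/
abbrev Mat (n : ℕ) := Fin n → Fin n → ℤ

/-- `a` is strictly lower triangular: `a i j = 0` unless `j < i`. -/
def SLT {n : ℕ} (a : Mat n) : Prop := ∀ i j : Fin n, a i j ≠ 0 → (j : ℕ) < (i : ℕ)

section Defs

variable (n : ℕ)

/-- The linear form `α_i = ∑_{j<i} a_{ij} x_j` (the terms with `j ≥ i` vanish for a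
strictly lower triangular matrix). -/
noncomputable def alpha (a : Mat n) (i : Fin n) : MvPolynomial (Fin n) ℤ :=
  ∑ j, C (a i j) * X j

/-- The ideal `(x_i² − α_i x_i : 1 ≤ i ≤ n)`. -/
noncomputable def bottIdeal (a : Mat n) : Ideal (MvPolynomial (Fin n) ℤ) :=
  Ideal.span (Set.range fun i : Fin n => X i ^ 2 - alpha n a i * X i)

/-- The Bott ring `R_A = ℤ[x_1,…,x_n]/(x_i² − α_i x_i)`. -/
abbrev BRing (a : Mat n) := MvPolynomial (Fin n) ℤ ⧸ bottIdeal n a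

/-- Quotient projection onto the Bott ring. -/
noncomputable def bmk (a : Mat n) : MvPolynomial (Fin n) ℤ →+* BRing n a :=
  Ideal.Quotient.mk _

/-- The class `x_i` in the Bott ring (0-based: `bx a i` is the paper's `x_{i+1}`). -/
noncomputable def bx (a : Mat n) (i : Fin n) : BRing n a := bmk n a (X i)

/-- The class of `α_i` in the Bott ring. -/
noncomputable def bal (a : Mat n) (i : Fin n) : BRing n a := bmk n a (alpha n a i)

/-- `F_k(A)`: the span of the first `k` degree-2 generators (paper's `x_1, …, x_k`,
0-based indices `< k`). -/
noncomputable def F (a : Mat n) (k : ℕ) : Submodule ℤ (BRing n a) :=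
  Submodule.span ℤ (bx n a '' {i : Fin n | (i : ℕ) < k})

/-- `H²(A)`: the span of all the degree-2 generators. -/
noncomputable def H2 (a : Mat n) : Submodule ℤ (BRing n a) :=
  Submodule.span ℤ (Set.range (bx n a))

/-- `ht(η) = min {k | η ∈ F_k(A)}`. -/
noncomputable def ht (a : Mat n) (η : BRing n a) : ℕ := sInf {k | η ∈ F n a k}

/-- A ring isomorphism between Bott rings is graded iff it preserves the degree-2
components in both directions (both rings are generated in degree 2, so this is
equivalent to preserving the whole grading). -/
def IsGraded (a b : Mat n) (φ : BRing n a ≃+* BRing n b) : Prop :=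
  (∀ z ∈ H2 n a, φ z ∈ H2 n b) ∧ (∀ z ∈ H2 n b, φ.symm z ∈ H2 n a)

/-- `φ` is `k`-stable: `φ(F_k(A)) ⊆ F_k(B)`. -/
def IsStable (a b : Mat n) (k : ℕ) (φ : BRing n a ≃+* BRing n b) : Prop :=
  ∀ z ∈ F n a k, φ z ∈ F n b k

/-! ### Rationalizations -/

/-- The linear form `α_i` with rational coefficients. -/
noncomputable def alphaQ (a : Mat n) (i : Fin n) : MvPolynomial (Fin n) ℚ :=
  ∑ j, C ((a i j : ℚ)) * X j

noncomputable def bottIdealQ (a : Mat n) : Ideal (MvPolynomial (Fin n) ℚ) :=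
  Ideal.span (Set.range fun i : Fin n => X i ^ 2 - alphaQ n a i * X i)

/-- The rationalized Bott ring `R_A ⊗ ℚ`. -/
abbrev BRingQ (a : Mat n) := MvPolynomial (Fin n) ℚ ⧸ bottIdealQ n a

noncomputable def bmkQ (a : Mat n) : MvPolynomial (Fin n) ℚ →+* BRingQ n a :=
  Ideal.Quotient.mk _

noncomputable def bxQ (a : Mat n) (i : Fin n) : BRingQ n a := bmkQ n a (X i)

noncomputable def balQ (a : Mat n) (i : Fin n) : BRingQ n a := bmkQ n a (alphaQ n a i)

/-- `F_k(A) ⊗ ℚ` inside `R_A ⊗ ℚ`. -/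
noncomputable def FQ (a : Mat n) (k : ℕ) : Submodule ℚ (BRingQ n a) :=
  Submodule.span ℚ (bxQ n a '' {i : Fin n | (i : ℕ) < k})

/-- The canonical map `R_A → R_A ⊗ ℚ`. -/
noncomputable def toQ (a : Mat n) : BRing n a →+* BRingQ n a :=
  Ideal.Quotient.lift (bottIdeal n a)
    ((bmkQ n a).comp (MvPolynomial.map (Int.castRingHom ℚ)))
    (by
      intro p hp
      have hmap : ∀ i : Fin n,
          MvPolynomial.map (Int.castRingHom ℚ) (alpha n a i) = alphaQ n a i := by
        intro i
        simp [alpha, alphaQ, map_sum]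
      have h : bottIdeal n a ≤
          Ideal.comap (MvPolynomial.map (Int.castRingHom ℚ)) (bottIdealQ n a) := by
        rw [bottIdeal, Ideal.span_le]
        rintro _ ⟨i, rfl⟩
        simp only [SetLike.mem_coe, Ideal.mem_comap, map_sub, map_mul, map_pow,
          MvPolynomial.map_X, hmap]
        exact Ideal.subset_span ⟨i, rfl⟩
      rw [RingHom.comp_apply]
      exact Ideal.Quotient.eq_zero_iff_mem.mpr (h hp))

/-- The truncated linear form `β̄_ℓ` (rational version): for a 0-based row index `li`,
this is `∑_{k ≤ j < li} b_{li,j} y_j`, i.e. the paper's `β_ℓ` with its terms in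
`F_k(B)` removed. -/
noncomputable def bbarQ (b : Mat n) (k : ℕ) (li : Fin n) : BRingQ n b :=
  ∑ j ∈ Finset.univ.filter (fun j : Fin n => k ≤ (j : ℕ) ∧ j < li),
    (b li j : ℚ) • bxQ n b j

/-- Half of the truncated linear form `β̄_ℓ / 2` (meaningful when all relevant entries
are even), as an element of the integral Bott ring. -/
noncomputable def bbarHalf (b : Mat n) (k : ℕ) (li : Fin n) : BRing n b :=
  ∑ j ∈ Finset.univ.filter (fun j : Fin n => k ≤ (j : ℕ) ∧ j < li),
    (b li j / 2) • bx n b j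

/-! ### Switching and twisting -/

/-- The matrix obtained from `b` by exchanging the rows and columns `p` and `q`. -/
def swapMat (b : Mat n) (p q : Fin n) : Mat n :=
  fun i j => b (Equiv.swap p q i) (Equiv.swap p q j)

/-- `g : R_C → R_{C'}` is a switching isomorphism: for some `j` (0-based `J`) with
`c_{j+1,j} = 0`, `C'` is obtained from `C` by exchanging the `j`-th and `(j+1)`-st rows
and columns, and `g` swaps the `j`-th and `(j+1)`-st generators and fixes the others. -/
def IsSwitch (c c' : Mat n) (g : BRing n c ≃+* BRing n c') : Prop :=
  IsGraded n c c' g ∧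
  ∃ (J : ℕ) (hJ : J + 1 < n),
    c ⟨J + 1, hJ⟩ ⟨J, by omega⟩ = 0 ∧
    c' = swapMat n c ⟨J, by omega⟩ ⟨J + 1, hJ⟩ ∧
    ∀ i, g (bx n c i) = bx n c' (Equiv.swap (⟨J, by omega⟩ : Fin n) ⟨J + 1, hJ⟩ i)

/-- `g : R_C → R_{C'}` is a twisting isomorphism: for some `j` (0-based `J`) and
`v ∈ F_{j−1}(C)` with `v(γ_j − v) = 0`, the rows of `C'` before `j` agree with those of
`C`, `γ'_j = γ_j − 2v`, and `g` is a graded isomorphism fixing the first `j−1`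
generators. -/
def IsTwist (c c' : Mat n) (g : BRing n c ≃+* BRing n c') : Prop :=
  IsGraded n c c' g ∧
  ∃ (J : ℕ) (hJ : J < n) (v : BRing n c),
    v ∈ F n c J ∧ v * (bal n c ⟨J, hJ⟩ - v) = 0 ∧
    (∀ i : Fin n, (i : ℕ) < J → ∀ m, c' i m = c i m) ∧
    ((∑ m, c' ⟨J, hJ⟩ m • bx n c m) = bal n c ⟨J, hJ⟩ - 2 • v) ∧
    (∀ i : Fin n, (i : ℕ) < J → g (bx n c i) = bx n c' i)

/-- `IsMoveComp n c c' g` : `g : R_C → R_{C'}` is a finite (possibly empty) composition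
of switching and twisting isomorphisms. -/
inductive IsMoveComp : ∀ c c' : Mat n, (BRing n c ≃+* BRing n c') → Prop
  | refl (c : Mat n) : IsMoveComp c c (RingEquiv.refl _)
  | switch {c c' c'' : Mat n} {g : BRing n c ≃+* BRing n c'}
      {g' : BRing n c' ≃+* BRing n c''} :
      IsMoveComp c c' g → IsSwitch n c' c'' g' → IsMoveComp c c'' (g.trans g')
  | twist {c c' c'' : Mat n} {g : BRing n c ≃+* BRing n c'}
      {g' : BRing n c' ≃+* BRing n c''} :
      IsMoveComp c c' g → IsTwist n c' c'' g' → IsMoveComp c c'' (g.trans g')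

end Defs

/-! ### Block matrices for ℚ-trivial Bott manifolds -/

/-- Starting (0-based) index of the `s`-th block for the partition `lam`. -/
def blockStart (t : ℕ) (lam : Fin t → ℕ) (s : Fin t) : ℕ :=
  ∑ s' ∈ Finset.univ.filter (fun s' : Fin t => s' < s), lam s'

/-- The block-diagonal matrix with diagonal blocks `H_{λ_1}, …, H_{λ_t}`, where `H_j`
is the `j × j` strictly lower triangular matrix whose first column below the diagonal
consists of `1`s and whose other entries vanish. -/
def blockMat (n t : ℕ) (lam : Fin t → ℕ) : Mat n := fun i j =>
  if ∃ s : Fin t, (j : ℕ) = blockStart t lam s ∧ blockStart t lam s < (i : ℕ) ∧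
      (i : ℕ) < blockStart t lam s + lam s then 1 else 0

/-- `H²(ℋ_{λ_s})`: the subgroup of the degree-2 component spanned by the generators
belonging to the `s`-th block. -/
noncomputable def blockH2 (n t : ℕ) (lam : Fin t → ℕ) (s : Fin t) :
    Submodule ℤ (BRing n (blockMat n t lam)) :=
  Submodule.span ℤ (bx n (blockMat n t lam) ''
    {i : Fin n | blockStart t lam s ≤ (i : ℕ) ∧ (i : ℕ) < blockStart t lam s + lam s})

end Bott

namespace Bott

theorem exists_coeffs {R M : Type*} [CommRing R] [AddCommGroup M] [Module R M] {n : ℕ}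
    (v : Fin n → M) (S : Set (Fin n)) (x : M) (hx : x ∈ Submodule.span R (v '' S)) :
    ∃ d : Fin n → R, (∀ j, j ∉ S → d j = 0) ∧ x = ∑ j, d j • v j := by
  classical
  induction hx using Submodule.span_induction with
  | mem x h =>
    obtain ⟨i, hi, rfl⟩ := h
    refine ⟨Pi.single i 1, ?_, ?_⟩
    · intro j hj
      have : j ≠ i := by rintro rfl; exact hj hi
      simp [this]
    · simp [Pi.single_apply]
  | zero => exact ⟨0, by simp, by simp⟩
  | add x y _ _ h1 h2 =>
    obtain ⟨d, hd, rfl⟩ := h1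
    obtain ⟨e, he, rfl⟩ := h2
    exact ⟨d + e, fun j hj => by simp [hd j hj, he j hj],
      by simp [add_smul, Finset.sum_add_distrib]⟩
  | smul r x _ h =>
    obtain ⟨d, hd, rfl⟩ := h
    exact ⟨r • d, fun j hj => by simp [hd j hj], by simp [Finset.smul_sum, mul_smul]⟩

theorem bal_eq (n : ℕ) (a : Mat n) (i : Fin n) : bal n a i = ∑ j, a i j • bx n a j := by
  simp only [bal, alpha, map_sum, map_mul, bx]
  refine Finset.sum_congr rfl fun j _ => ?_
  rw [zsmul_eq_mul]
  congr 1

theorem bmkQ_C_mul (n : ℕ) (a : Mat n) (r : ℚ) (p : MvPolynomial (Fin n) ℚ) :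
    bmkQ n a (C r * p) = r • bmkQ n a p := by
  rw [← MvPolynomial.smul_eq_C_mul]
  rfl

theorem balQ_eq (n : ℕ) (a : Mat n) (i : Fin n) :
    balQ n a i = ∑ j, (a i j : ℚ) • bxQ n a j := by
  simp only [balQ, alphaQ, map_sum, bmkQ_C_mul, bxQ]

theorem bx_sq (n : ℕ) (a : Mat n) (i : Fin n) :
    bx n a i * bx n a i = bal n a i * bx n a i := by
  have h : bmk n a (X i ^ 2 - alpha n a i * X i) = 0 :=
    Ideal.Quotient.eq_zero_iff_mem.mpr (Ideal.subset_span ⟨i, rfl⟩)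
  rw [map_sub, map_pow, map_mul, sub_eq_zero, pow_two] at h
  exact h

theorem toQ_bx (n : ℕ) (a : Mat n) (i : Fin n) : toQ n a (bx n a i) = bxQ n a i := by
  simp only [toQ, bx, bmk, Ideal.Quotient.lift_mk, RingHom.comp_apply, MvPolynomial.map_X, bxQ]

theorem toQ_lin (n : ℕ) (a : Mat n) (c : Fin n → ℤ) :
    toQ n a (∑ j, c j • bx n a j) = ∑ j, (c j : ℚ) • bxQ n a j := by
  simp only [map_sum, map_zsmul, toQ_bx]
  refine Finset.sum_congr rfl fun j _ => ?_
  rw [Int.cast_smul_eq_zsmul]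

/-- Linear independence of the generators in the rational Bott ring. -/
theorem linQ (n : ℕ) (b : Mat n) (s t : Fin n → ℚ)
    (h : ∑ j, s j • bxQ n b j = ∑ j, t j • bxQ n b j) (i : Fin n) : s i = t i := by
  classical
  let f : MvPolynomial (Fin n) ℚ →ₐ[ℚ] DualNumber ℚ :=
    aeval (fun j => if j = i then DualNumber.eps else 0)
  have hf : ∀ p ∈ bottIdealQ n b, f p = 0 := by
    intro p hp
    have : bottIdealQ n b ≤ RingHom.ker f := by
      rw [bottIdealQ, Ideal.span_le]
      rintro _ ⟨m, rfl⟩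
      rw [SetLike.mem_coe, RingHom.mem_ker, map_sub, map_mul, map_pow]
      simp only [f, alphaQ, map_sum, map_mul, aeval_X, pow_two, Finset.sum_mul]
      by_cases hm : m = i
      · simp [hm, mul_assoc]
      · simp [hm]
    exact this hp
  have h0 : ∑ j, C (s j) * X j - ∑ j, C (t j) * X j ∈ bottIdealQ n b := by
    apply Ideal.Quotient.eq_zero_iff_mem.mp
    change bmkQ n b _ = 0
    rw [map_sub, map_sum, map_sum, sub_eq_zero]
    simp only [bmkQ_C_mul]
    exact h
  have h1 := congrArg TrivSqZeroExt.snd (hf _ h0)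
  simp [f, map_sum, TrivSqZeroExt.algebraMap_eq_inl] at h1
  linarith

/-- If a product of two linear forms vanishes, the coefficients satisfy quadratic relations. -/
theorem quad (n : ℕ) (b : Mat n) (hb : SLT b) (s t : Fin n → ℤ)
    (h : (∑ j, s j • bx n b j) * (∑ j, t j • bx n b j) = 0) (i j : Fin n) (hij : j < i) :
    s i * t j + s j * t i + s i * t i * b i j = 0 := by
  classical
  let e1 : DualNumber (DualNumber ℚ) := TrivSqZeroExt.inl DualNumber.eps
  let e2 : DualNumber (DualNumber ℚ) := DualNumber.eps
  have h11 : e1 * e1 = 0 := by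
    simp [e1, ← TrivSqZeroExt.inl_mul]
  have h22 : e2 * e2 = 0 := by simp [e2]
  let q : DualNumber (DualNumber ℚ) := algebraMap ℚ _ ((b i j : ℚ) / 2)
  have hq : 2 * q = ((b i j : ℤ) : DualNumber (DualNumber ℚ)) := by
    have : (2 : DualNumber (DualNumber ℚ)) = algebraMap ℚ _ 2 := (map_ofNat _ 2).symm
    rw [this, ← map_mul]
    have h2 : (2 : ℚ) * ((b i j : ℚ) / 2) = ((b i j : ℤ) : ℚ) := by ring
    rw [h2, map_intCast]
  let g : Fin n → DualNumber (DualNumber ℚ) :=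
    fun m => if m = i then e2 + q * e1 else if m = j then e1 else 0
  have hji : j ≠ i := ne_of_lt hij
  have gi : g i = e2 + q * e1 := by simp [g]
  have gj : g j = e1 := by simp [g, hji]
  have gsum : ∀ c : Fin n → DualNumber (DualNumber ℚ),
      ∑ m, c m * g m = c i * g i + c j * g j := by
    intro c
    rw [← Finset.sum_pair hji.symm (f := fun m => c m * g m)]
    symm
    apply Finset.sum_subset (Finset.subset_univ _)
    intro m _ hm
    simp at hm
    simp [g, hm.1, hm.2]
  let f : MvPolynomial (Fin n) ℤ →ₐ[ℤ] DualNumber (DualNumber ℚ) := aeval g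
  have flin : ∀ c : Fin n → ℤ, f (∑ m, C (c m) * X m) = c i * g i + c j * g j := by
    intro c
    rw [← gsum (fun m => (c m : DualNumber (DualNumber ℚ)))]
    simp [f]
  have hz : ∀ i j : Fin n, ¬ j < i → b i j = 0 := by
    intro i j hij
    by_contra hne
    exact hij (hb i j hne)
  have hf : bottIdeal n b ≤ RingHom.ker f := by
    rw [bottIdeal, Ideal.span_le]
    rintro _ ⟨m, rfl⟩
    rw [SetLike.mem_coe, RingHom.mem_ker, map_sub, map_mul, map_pow, alpha, flin]
    have fX : f (X m) = g m := by simp [f]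
    rw [fX]
    by_cases hm : m = i
    · subst hm
      rw [hz m m (lt_irrefl _), gi, gj, ← hq]
      push_cast
      linear_combination h22 + (q ^ 2 - 2 * q ^ 2) * h11
    · by_cases hm' : m = j
      · subst hm'
        rw [hz m m (lt_irrefl _), hz m i (not_lt.mpr hij.le), gj]
        push_cast
        linear_combination h11
      · have : g m = 0 := by simp [g, hm, hm']
        rw [this]; ring
  have h0 : (∑ m, C (s m) * X m) * (∑ m, C (t m) * X m) ∈ bottIdeal n b := by
    apply Ideal.Quotient.eq_zero_iff_mem.mp
    change bmk n b _ = 0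
    rw [map_mul]
    have key : ∀ c : Fin n → ℤ, bmk n b (∑ m, C (c m) * X m) = ∑ m, c m • bx n b m := by
      intro c
      rw [map_sum]
      refine Finset.sum_congr rfl fun m _ => ?_
      rw [map_mul, zsmul_eq_mul]
      congr 1
    rw [key, key, h]
  have h1 : f _ = 0 := hf h0
  rw [map_mul, flin, flin, gi, gj] at h1
  have h2 : (((s i * t j + s j * t i + s i * t i * b i j : ℤ)) : DualNumber (DualNumber ℚ))
      * (e1 * e2) = 0 := by
    push_cast
    rw [← hq]
    linear_combination h1 - (s i * t i : DualNumber (DualNumber ℚ)) * h22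
      - ((s i * t i : DualNumber (DualNumber ℚ)) * q ^ 2 + s i * t j * q + s j * t i * q
        + s j * t j) * h11
  have h3 := congrArg (fun z => TrivSqZeroExt.snd (TrivSqZeroExt.snd z)) h2
  rw [← zsmul_eq_mul] at h3
  simp [e1, e2] at h3
  exact_mod_cast h3

/-- Conversely, the quadratic relations force the product to vanish. -/
theorem quad_conv (n : ℕ) (b : Mat n) (hb : SLT b) (s t : Fin n → ℤ)
    (h : ∀ i j : Fin n, j < i → s i * t j + s j * t i + s i * t i * b i j = 0) :
    (∑ j, s j • bx n b j) * (∑ j, t j • bx n b j) = 0 := by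
  classical
  set y := bx n b with hy
  have hsplit : ∀ f : Fin n → Fin n → BRing n b, ∑ i, ∑ j, f i j =
      ∑ i, (f i i + ∑ j, if j < i then f i j + f j i else 0) := by
    intro f
    have e1 : ∀ i j, f i j = (if i = j then f i j else 0) + (if j < i then f i j else 0)
        + (if i < j then f i j else 0) := by
      intro i j
      rcases lt_trichotomy i j with h | h | h
      · simp [h, h.ne, h.not_gt]
      · simp [h]
      · simp [h, h.ne', h.not_gt]
    have e2 : ∑ i, ∑ j, (if i < j then f i j else 0) = ∑ i, ∑ j, if j < i then f j i else 0 :=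
      Finset.sum_comm
    rw [Finset.sum_congr rfl fun i _ => Finset.sum_congr rfl fun j _ => e1 i j]
    simp only [Finset.sum_add_distrib]
    rw [e2]
    simp only [Finset.sum_ite_eq, Finset.mem_univ, if_true]
    rw [add_assoc, ← Finset.sum_add_distrib]
    congr 1
    refine Finset.sum_congr rfl fun i _ => ?_
    rw [← Finset.sum_add_distrib]
    refine Finset.sum_congr rfl fun j _ => ?_
    split_ifs <;> simp
  rw [Finset.sum_mul_sum, hsplit]
  refine Finset.sum_eq_zero fun i _ => ?_
  have hii : (s i • y i) * (t i • y i) =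
      ∑ j, if j < i then (s i * t i * b i j) • (y j * y i) else 0 := by
    have : (s i • y i) * (t i • y i) = (s i * t i) • (y i * y i) := by
      simp only [zsmul_eq_mul]; push_cast; ring
    rw [this, hy, bx_sq, bal_eq, Finset.sum_mul, Finset.smul_sum]
    refine Finset.sum_congr rfl fun j _ => ?_
    split_ifs with hlt
    · simp only [zsmul_eq_mul]; push_cast; ring
    · have : b i j = 0 := by
        by_contra hne
        exact hlt (hb i j hne)
      simp [this]
  rw [hii, ← Finset.sum_add_distrib]
  refine Finset.sum_eq_zero fun j _ => ?_
  split_ifs with hlt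
  · have := congrArg (fun z : ℤ => (z : BRing n b)) (h i j hlt)
    push_cast at this
    simp only [zsmul_eq_mul]; push_cast
    linear_combination (y j * y i) * this
  · simp

/-- Let `φ : R_A → R_B` be a `k`-stable graded ring isomorphism,
`ℓ := ht(φ(x_{k+1})) > k + 1`, and assume `p := b_{ℓ,ℓ−1}` is odd.  Write
`φ(x_{k+1}) = ε(2y_ℓ − β̄_ℓ) + w` with `ε` nonzero rational and `w ∈ F_k(B) ⊗ ℚ`, and
set `u := (φ(α_{k+1}) − 2w)/ε`.  Then: (i) `β_{ℓ−1} = β̄_{ℓ−1} − u/p` in `H²(B) ⊗ ℚ`;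
(ii) every coefficient `b_{ℓ−1,j}` (`k + 1 ≤ j ≤ ℓ − 2`, i.e. 0-based
`k ≤ j < ℓ − 2`) is even, so `v := β̄_{ℓ−1}/2` lies in `F_{ℓ−2}(B)`; and
(iii) `v(β_{ℓ−1} − v) = 0` in `R_B`. -/
theorem stmt_13 (n k : ℕ) (hk : k < n) (a b : Mat n) (ha : SLT a) (hb : SLT b)
    (φ : BRing n a ≃+* BRing n b) (hφ : IsGraded n a b φ) (hst : IsStable n a b k φ)
    (l : ℕ) (hl : l = ht n b (φ (bx n a ⟨k, hk⟩))) (hlk : k + 1 < l) (hln : l ≤ n)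
    (hp : Odd (b ⟨l - 1, by omega⟩ ⟨l - 2, by omega⟩))
    (ε : ℚ) (hε : ε ≠ 0) (w : BRingQ n b) (hw : w ∈ FQ n b k)
    (hrep : toQ n b (φ (bx n a ⟨k, hk⟩)) =
      ε • (2 * bxQ n b ⟨l - 1, by omega⟩ - bbarQ n b k ⟨l - 1, by omega⟩) + w) :
    balQ n b ⟨l - 2, by omega⟩ =
        bbarQ n b k ⟨l - 2, by omega⟩ -
          ((b ⟨l - 1, by omega⟩ ⟨l - 2, by omega⟩ : ℚ))⁻¹ •
            (ε⁻¹ • (toQ n b (φ (bal n a ⟨k, hk⟩)) - 2 • w)) ∧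
    (∀ j : Fin n, k ≤ (j : ℕ) → (j : ℕ) < l - 2 → Even (b ⟨l - 2, by omega⟩ j)) ∧
    bbarHalf n b k ⟨l - 2, by omega⟩ ∈ F n b (l - 2) ∧
    bbarHalf n b k ⟨l - 2, by omega⟩ *
        (bal n b ⟨l - 2, by omega⟩ - bbarHalf n b k ⟨l - 2, by omega⟩) = 0 := by
  classical
  set K : Fin n := ⟨k, hk⟩ with hK
  set L : Fin n := ⟨l - 1, by omega⟩ with hL
  set M : Fin n := ⟨l - 2, by omega⟩ with hM
  have hz : ∀ i j : Fin n, ¬ j < i → b i j = 0 := by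
    intro i j hij
    by_contra hne
    exact hij (hb i j hne)
  -- coefficients
  have hx2 : φ (bx n a K) ∈ H2 n b := hφ.1 _ (Submodule.subset_span ⟨K, rfl⟩)
  obtain ⟨c, hc⟩ := (Submodule.mem_span_range_iff_exists_fun ℤ).mp hx2
  have hα : φ (bal n a K) ∈ F n b k := by
    apply hst
    rw [bal_eq]
    refine Submodule.sum_mem _ fun j _ => ?_
    by_cases h0 : a K j = 0
    · simp [h0]
    · exact Submodule.smul_mem _ _ (Submodule.subset_span ⟨j, ha K j h0, rfl⟩)
  obtain ⟨d, hd0, hd⟩ := exists_coeffs (bx n b) _ _ hα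
  obtain ⟨ω, hω0, hω⟩ := exists_coeffs (bxQ n b) _ _ hw
  have hd0' : ∀ j : Fin n, k ≤ (j : ℕ) → d j = 0 := fun j hj => hd0 j (by simpa using hj)
  have hω0' : ∀ j : Fin n, k ≤ (j : ℕ) → ω j = 0 := fun j hj => hω0 j (by simpa using hj)
  have bbar_eq : ∀ m : Fin n, bbarQ n b k m =
      ∑ j : Fin n, (if k ≤ (j : ℕ) then (b m j : ℚ) else 0) • bxQ n b j := by
    intro m
    rw [bbarQ, Finset.sum_filter]
    refine Finset.sum_congr rfl fun j _ => ?_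
    by_cases h1 : k ≤ (j : ℕ)
    · by_cases h2 : j < m
      · simp [h1, h2]
      · simp [h1, h2, hz m j h2]
    · simp [h1]
  -- relation from the ring structure
  have hprod : (∑ j, c j • bx n b j) * (∑ j, (c j - d j) • bx n b j) = 0 := by
    simp only [sub_smul, Finset.sum_sub_distrib]
    rw [hc, ← hd, ← map_sub, ← map_mul, mul_sub, bx_sq, mul_comm (bal n a K), sub_self, map_zero]
  have hq := quad n b hb _ _ hprod
  -- coefficients from the representation
  have hcoef : ∀ j : Fin n, (c j : ℚ) =
      ε * ((if j = L then 2 else 0) - (if k ≤ (j : ℕ) then (b L j : ℚ) else 0)) + ω j := by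
    apply linQ n b
    rw [← toQ_lin, hc, hrep, bbar_eq, hω]
    simp only [add_smul, mul_smul, sub_smul, Finset.sum_add_distrib, Finset.sum_sub_distrib,
      ← Finset.smul_sum]
    congr 3
    simp [ite_smul, two_smul, two_mul]
  have hkM : k ≤ (M : ℕ) := by simp [hM]; omega
  have hML : M < L := by simp [hM, hL, Fin.lt_def]; omega
  set p : ℤ := b L M with hpdef
  have hp0 : p ≠ 0 := by
    intro h
    rw [h] at hp
    exact absurd hp (by decide)
  have hpQ : (p : ℚ) ≠ 0 := by exact_mod_cast hp0
  have hcmid : ∀ j : Fin n, k ≤ (j : ℕ) → j < L → (c j : ℚ) = -ε * b L j := by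
    intro j h1 h2
    rw [hcoef j, hω0' j h1]
    simp [h1, h2.ne]
  have hclow : ∀ j : Fin n, (j : ℕ) < k → (c j : ℚ) = ω j := by
    intro j h1
    have h2 : j ≠ L := by
      rintro rfl
      have : (M : ℕ) < (L : ℕ) := hML
      omega
    rw [hcoef j]
    simp [h2, not_le.mpr h1]
  have hcM : (c M : ℚ) = -ε * p := hcmid M hkM hML
  have hcM0 : (c M : ℚ) ≠ 0 := by
    rw [hcM]; exact mul_ne_zero (neg_ne_zero.mpr hε) hpQ
  have hqQ : ∀ i j : Fin n, j < i → k ≤ (i : ℕ) →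
      (c i : ℚ) * (2 * c j - d j + c i * b i j) = 0 := by
    intro i j hij hi
    have h1 := hq i j hij
    simp only [hd0' i hi, sub_zero] at h1
    have h2 : ((c i * (c j - d j) + c j * c i + c i * c i * b i j : ℤ) : ℚ) = 0 := by
      rw [h1]; simp
    push_cast at h2
    linear_combination h2
  have hM1 : ∀ j : Fin n, j < M → 2 * (c j : ℚ) - d j = ε * p * b M j := by
    intro j hj
    have h1 := (mul_eq_zero.mp (hqQ M j hj hkM)).resolve_left hcM0
    rw [hcM] at h1
    linear_combination h1
  have hMmid : ∀ j : Fin n, k ≤ (j : ℕ) → j < M → p * b M j = -2 * b L j := by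
    intro j h1 h2
    have h3 := hM1 j h2
    rw [hcmid j h1 (h2.trans hML), hd0' j h1] at h3
    have h4 : ε * ((p : ℚ) * b M j) = ε * (-2 * b L j) := by
      push_cast at h3
      linear_combination -h3
    have h5 := mul_left_cancel₀ hε h4
    exact_mod_cast h5
  have hev : ∀ j : Fin n, k ≤ (j : ℕ) → j < M → Even (b M j) := by
    intro j h1 h2
    have h3 := hMmid j h1 h2
    have h4 : Even (p * b M j) := by
      rw [h3]; exact ⟨-b L j, by ring⟩
    rcases Int.even_mul.mp h4 with h5 | h5
    · exact absurd h5 (Int.not_even_iff_odd.mpr hp)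
    · exact h5
  refine ⟨?_, ?_, ?_, ?_⟩
  · rw [balQ_eq, bbar_eq, hd, toQ_lin, hω]
    simp only [Finset.smul_sum, ← Finset.sum_sub_distrib]
    refine Finset.sum_congr rfl fun j _ => ?_
    have key : (b M j : ℚ) = (if k ≤ (j : ℕ) then (b M j : ℚ) else 0)
        - (p : ℚ)⁻¹ * (ε⁻¹ * (d j - 2 * ω j)) := by
      by_cases h1 : k ≤ (j : ℕ)
      · simp [h1, hd0' j h1, hω0' j h1]
      · have h2 : j < M := by
          rw [Fin.lt_def]; omega
        have h3 := hM1 j h2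
        rw [hclow j (not_le.mp h1)] at h3
        simp only [h1, if_false]
        field_simp
        linear_combination -h3
    conv_lhs => rw [key]
    simp only [sub_smul, mul_smul, smul_sub, two_smul]
  · intro j h1 h2
    exact hev j h1 h2
  · refine Submodule.sum_mem _ fun j hj => ?_
    refine Submodule.smul_mem _ _ (Submodule.subset_span ⟨j, ?_, rfl⟩)
    exact (Finset.mem_filter.mp hj).2.2
  · let v : Fin n → ℤ := fun j => if k ≤ (j : ℕ) ∧ j < M then b M j / 2 else 0
    have hv : bbarHalf n b k M = ∑ j, v j • bx n b j := by
      rw [bbarHalf, Finset.sum_filter]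
      refine Finset.sum_congr rfl fun j _ => ?_
      simp only [v]
      split_ifs <;> simp
    have hv2 : bal n b M - bbarHalf n b k M = ∑ j, (b M j - v j) • bx n b j := by
      rw [bal_eq, hv]
      simp only [sub_smul, Finset.sum_sub_distrib]
    rw [hv2, hv]
    have hvmid : ∀ j : Fin n, k ≤ (j : ℕ) → j < M → b M j = 2 * v j := by
      intro j h1 h2
      obtain ⟨r, hr⟩ := hev j h1 h2
      simp only [v, h1, h2, and_self, if_true]
      omega
    have hvlow : ∀ j : Fin n, (j : ℕ) < k → v j = 0 := by
      intro j h1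
      simp [v, not_le.mpr h1]
    have hvhigh : ∀ j : Fin n, ¬ j < M → v j = 0 := by
      intro j h1
      simp only [v, h1, and_false, if_false]
    have hcv : ∀ j : Fin n, k ≤ (j : ℕ) → j < M → (c j : ℚ) = ε * p * v j := by
      intro j h1 h2
      have h3 := hM1 j h2
      rw [hd0' j h1, hvmid j h1 h2] at h3
      push_cast at h3
      linear_combination h3 / 2
    apply quad_conv n b hb
    intro i j hij
    by_cases hiM : i < M
    · by_cases hik : k ≤ (i : ℕ)
      · have h1 := hqQ i j hij hik
        have hjM : j < M := hij.trans hiM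
        rw [hM1 j hjM, hcv i hik hiM] at h1
        have h2 : (ε * p) ^ 2 * ((v i : ℚ) * (b M j + v i * b i j)) = 0 := by
          linear_combination h1
        have h3 := (mul_eq_zero.mp h2).resolve_left (pow_ne_zero 2 (mul_ne_zero hε hpQ))
        have h4 : v i * (b M j + v i * b i j) = 0 := by exact_mod_cast h3
        rw [hvmid i hik hiM]
        linear_combination h4
      · have hik' := not_le.mp hik
        have hjk : (j : ℕ) < k := lt_trans hij hik'
        rw [hvlow i hik', hvlow j hjk]
        ring
    · rw [hvhigh i hiM, hz M i (fun h => hiM h)]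
      ring


end Bott
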